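/- arXiv:1903.11057 — 2 statements merged into one kernel-verified Lean document; each statement's English description precedes it below -/
import Mathlib

section
/- For every natural number k and all integers r, s, n, m: −q^{r−s}·u(m−r)·∑_{j=0}^{k} u(m−s)^{k−j}·u(r−s)^j·w(n−(m−r)k−(m−s)+(m−r)j) = u(r−s)^{k+1}·w(n) − u(m−s)^{k+1}·w(n−(m−r)(k+1)). -/
theorem eq_zero_of_two_term_recurrence {p q : ℂ} (hq : q ≠ 0) {f : ℤ → ℂ}
    (hf : ∀ n : ℤ, f n = p * f (n - 1) - q * f (n - 2)) (h0 : f 0 = 0) (h1 : f 1 = 0) (n : ℤ) :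
    f n = 0 := by
  suffices h : f n = 0 ∧ f (n + 1) = 0 from h.1
  induction n using Int.induction_on with
  | zero => exact ⟨h0, by simpa using h1⟩
  | succ i ih =>
    refine ⟨ih.2, ?_⟩
    rw [hf, show (i : ℤ) + 1 + 1 - 1 = i + 1 by ring, show (i : ℤ) + 1 + 1 - 2 = i by ring,
      ih.1, ih.2]
    ring
  | pred i ih =>
    have h := hf (-(i : ℤ) + 1)
    rw [show -(i : ℤ) + 1 - 1 = -i by ring, show -(i : ℤ) + 1 - 2 = -i - 1 by ring,
      ih.1, ih.2] at h
    refine ⟨?_, by simpa using ih.1⟩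
    have h' : q * f (-(i : ℤ) - 1) = 0 := by linear_combination h
    exact (mul_eq_zero.mp h').resolve_left hq

theorem lucas_mul_horadam_succ {p q : ℂ} (hq : q ≠ 0) {w u : ℤ → ℂ}
    (hw : ∀ n : ℤ, w n = p * w (n - 1) - q * w (n - 2)) (hu0 : u 0 = 0) (hu1 : u 1 = 1)
    (hu : ∀ n : ℤ, u n = p * u (n - 1) - q * u (n - 2)) (i n : ℤ) :
    u i * w (n + 1) - u (i + 1) * w n + q ^ i * w (n - i) = 0 := by
  have hu2 : u 2 = p := by
    have h := hu 2
    norm_num [hu0, hu1] at h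
    exact h
  refine eq_zero_of_two_term_recurrence (p := p) hq
    (f := fun i => u i * w (n + 1) - u (i + 1) * w n + q ^ i * w (n - i)) ?_ ?_ ?_ i
  · intro i
    have e1 := hu i
    have e2 := hu (i + 1)
    have e3 := hw (n - i + 2)
    have z1 : q ^ (i - 1) = q ^ (i - 2) * q := by
      rw [← zpow_add_one₀ hq]; congr 1; ring
    have z2 : q ^ i = q ^ (i - 2) * q * q := by
      rw [← z1, ← zpow_add_one₀ hq]; congr 1; ring
    rw [show i + 1 - 1 = i by ring, show i + 1 - 2 = i - 1 by ring] at e2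
    rw [show n - i + 2 - 1 = n - i + 1 by ring, show n - i + 2 - 2 = n - i by ring] at e3
    simp only [show i - 1 + 1 = i by ring, show i - 2 + 1 = i - 1 by ring,
      show n - (i - 1) = n - i + 1 by ring, show n - (i - 2) = n - i + 2 by ring]
    rw [z1, z2]
    linear_combination w (n + 1) * e1 - w n * e2 + q ^ (i - 2) * q * e3
  · simp [hu0, hu1]
  · have e := hw (n + 1)
    rw [show n + 1 - 1 = n by ring, show n + 1 - 2 = n - 1 by ring] at e
    simp only [hu1, one_add_one_eq_two, hu2, zpow_one]
    linear_combination e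

theorem lucas_mul_horadam_add {p q : ℂ} (hq : q ≠ 0) {w u : ℤ → ℂ}
    (hw : ∀ n : ℤ, w n = p * w (n - 1) - q * w (n - 2)) (hu0 : u 0 = 0) (hu1 : u 1 = 1)
    (hu : ∀ n : ℤ, u n = p * u (n - 1) - q * u (n - 2)) (i j n : ℤ) :
    u i * w (n + j) - u (j + i) * w n + q ^ i * u j * w (n - i) = 0 := by
  refine eq_zero_of_two_term_recurrence (p := p) hq
    (f := fun j => u i * w (n + j) - u (j + i) * w n + q ^ i * u j * w (n - i)) ?_ ?_ ?_ j
  · intro j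
    have e1 := hw (n + j)
    have e2 := hu (j + i)
    have e3 := hu j
    simp only [show n + (j - 1) = n + j - 1 by ring, show n + (j - 2) = n + j - 2 by ring,
      show j - 1 + i = j + i - 1 by ring, show j - 2 + i = j + i - 2 by ring]
    linear_combination u i * e1 - w n * e2 + q ^ i * w (n - i) * e3
  · simp [hu0]
  · have h := lucas_mul_horadam_succ hq hw hu0 hu1 hu i n
    simp only [hu1, add_comm 1 i]
    linear_combination h

theorem stmt_17 (p q a b : ℂ) (hq : q ≠ 0) (w u : ℤ → ℂ)
    (hw0 : w 0 = a) (hw1 : w 1 = b)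
    (hw : ∀ n : ℤ, w n = p * w (n - 1) - q * w (n - 2))
    (hu0 : u 0 = 0) (hu1 : u 1 = 1)
    (hu : ∀ n : ℤ, u n = p * u (n - 1) - q * u (n - 2))
    (k : ℕ) (r s n m : ℤ) :
    -q ^ (r - s) * u (m - r) * ∑ j ∈ Finset.range (k + 1), u (m - s) ^ (k - j) * u (r - s) ^ j * w (n - (m - r) * k - (m - s) + (m - r) * j) = u (r - s) ^ (k + 1) * w n - u (m - s) ^ (k + 1) * w (n - (m - r) * (k + 1)) := by
  have key (t : ℤ) : -q ^ (r - s) * u (m - r) * w (t - (m - s)) =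
      u (r - s) * w t - u (m - s) * w (t - (m - r)) := by
    have h := lucas_mul_horadam_add hq hw hu0 hu1 hu (r - s) (m - r) (t - (m - r))
    rw [show t - (m - r) + (m - r) = t by ring, show m - r + (r - s) = m - s by ring,
      show t - (m - r) - (r - s) = t - (m - s) by ring] at h
    linear_combination -h
  let G : ℕ → ℂ := fun j =>
    u (m - s) ^ (k + 1 - j) * u (r - s) ^ j * w (n - (m - r) * (k + 1 - j))
  have hG : ∀ j ∈ Finset.range (k + 1), -q ^ (r - s) * u (m - r) *
      (u (m - s) ^ (k - j) * u (r - s) ^ j * w (n - (m - r) * k - (m - s) + (m - r) * j)) =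
      G (j + 1) - G j := by
    intro j hj
    have hjk : j ≤ k := Nat.lt_succ_iff.mp (Finset.mem_range.mp hj)
    have h := key (n - (m - r) * (k - j))
    rw [show n - (m - r) * (k - j) - (m - s) = n - (m - r) * k - (m - s) + (m - r) * j by ring,
      show n - (m - r) * (k - j) - (m - r) = n - (m - r) * (k + 1 - j) by ring] at h
    simp only [G]
    rw [Nat.succ_sub hjk, Nat.add_sub_add_right, Nat.cast_succ,
      show (k : ℤ) + 1 - (j + 1) = k - j by ring, pow_succ, pow_succ]
    linear_combination u (m - s) ^ (k - j) * u (r - s) ^ j * h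
  rw [Finset.mul_sum, Finset.sum_congr rfl hG, Finset.sum_range_sub]
  simp [G]
end

section
/- Fix a natural number k and integers r, s, n, m, and assume that w(n−(m−r)k+(m−r)j) ≠ 0 and w(n−(m−r)−(m−r)k+(m−r)j) ≠ 0 for every j with 0 ≤ j ≤ k. Then −q^{r−s}·u(m−r)·w(n)·w(n−(m−r)(k+1))·∑_{j=0}^{k} u(r−s)^{k−j}·u(m−s)^j·w(n−m+s−(m−r)k+(m−r)j)/(w(n−(m−r)k+(m−r)j)·w(n−(m−r)−(m−r)k+(m−r)j)) = u(r−s)^{k+1}·w(n) − u(m−s)^{k+1}·w(n−(m−r)(k+1)). -/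
/-- A two-sided second order linear recurrence with invertible last coefficient is determined by
its values at `0` and `1`; in particular it vanishes if these do. -/
lemma eq_zero_of_recurrence {K : Type*} [Field K] {p q : K} (hq : q ≠ 0) {f : ℤ → K}
    (h0 : f 0 = 0) (h1 : f 1 = 0)
    (hf : ∀ n : ℤ, f n = p * f (n - 1) - q * f (n - 2)) (n : ℤ) : f n = 0 := by
  suffices h : f n = 0 ∧ f (n + 1) = 0 from h.1
  induction n using Int.induction_on with
  | zero => exact ⟨h0, by simpa using h1⟩
  | succ i ih =>
    refine ⟨ih.2, ?_⟩
    rw [hf, show (i : ℤ) + 1 + 1 - 1 = i + 1 by ring, show (i : ℤ) + 1 + 1 - 2 = i by ring,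
      ih.1, ih.2]
    ring
  | pred i ih =>
    have h := hf (-(i : ℤ) + 1)
    rw [show -(i : ℤ) + 1 - 1 = -i by ring, show -(i : ℤ) + 1 - 2 = -i - 1 by ring,
      ih.1, ih.2] at h
    refine ⟨?_, by simpa using ih.1⟩
    have h' : q * f (-(i : ℤ) - 1) = 0 := by linear_combination h
    exact (mul_eq_zero.mp h').resolve_left hq

/-- The addition formula expressing a Horadam sequence through the Lucas sequence. -/
lemma horadam_add {K : Type*} [Field K] {p q : K} (hq : q ≠ 0) {w u : ℤ → K}
    (hw : ∀ n : ℤ, w n = p * w (n - 1) - q * w (n - 2))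
    (hu0 : u 0 = 0) (hu1 : u 1 = 1)
    (hu : ∀ n : ℤ, u n = p * u (n - 1) - q * u (n - 2)) (y d : ℤ) :
    w (y + d) = u (d + 1) * w y - q * u d * w (y - 1) := by
  have hu2 : u 2 = p := by
    have h := hu 2
    norm_num [hu0, hu1] at h
    exact h
  rw [← sub_eq_zero]
  refine eq_zero_of_recurrence (p := p) hq
    (f := fun d => w (y + d) - (u (d + 1) * w y - q * u d * w (y - 1))) ?_ ?_ (fun d => ?_) d
  · simp [hu0, hu1]
  · have h := hw (y + 1)
    rw [show y + 1 - 1 = y by ring, show y + 1 - 2 = y - 1 by ring] at h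
    simp only [hu1, one_add_one_eq_two, hu2]
    linear_combination h
  · have h1 := hw (y + d)
    have h2 := hu (d + 1)
    have h3 := hu d
    simp only [add_sub_assoc] at h1
    simp only [add_sub_right_comm] at h2
    linear_combination h1 - w y * h2 + q * w (y - 1) * h3

/-- A d'Ocagne type identity for a Horadam sequence and its Lucas sequence. -/
lemma horadam_sub_mul {K : Type*} [Field K] {p q : K} (hq : q ≠ 0) {w u : ℤ → K}
    (hw : ∀ n : ℤ, w n = p * w (n - 1) - q * w (n - 2))
    (hu0 : u 0 = 0) (hu1 : u 1 = 1)
    (hu : ∀ n : ℤ, u n = p * u (n - 1) - q * u (n - 2)) (y c d : ℤ) :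
    u c * w (y + d) - u (c + d) * w y = -q ^ c * u d * w (y - c) := by
  rw [← sub_eq_zero]
  refine eq_zero_of_recurrence (p := p) hq
    (f := fun c => u c * w (y + d) - u (c + d) * w y - -q ^ c * u d * w (y - c))
    ?_ ?_ (fun c => ?_) c
  · simp [hu0]
  · have h := horadam_add hq hw hu0 hu1 hu y d
    simp only [hu1, add_comm (1 : ℤ) d, zpow_one]
    linear_combination h
  · have h1 := hu c
    have h2 := hu (c + d)
    have h3 := hw (y - (c - 2))
    rw [show y - (c - 2) - 1 = y - (c - 1) by ring, show y - (c - 2) - 2 = y - c by ring] at h3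
    simp only [add_sub_right_comm] at h2
    have e1 : q ^ c = q ^ (c - 2) * q ^ 2 := by
      rw [← zpow_natCast, ← zpow_add₀ hq]
      congr 1
      simp
    have e2 : q ^ (c - 1) = q ^ (c - 2) * q := by
      rw [← zpow_add_one₀ hq]
      congr 1
      ring
    simp only [e1, e2]
    linear_combination w (y + d) * h1 - w y * h2 + q * q ^ (c - 2) * u d * h3

theorem stmt_19 (p q a b : ℂ) (hq : q ≠ 0) (w u : ℤ → ℂ)
    (hw0 : w 0 = a) (hw1 : w 1 = b)
    (hw : ∀ n : ℤ, w n = p * w (n - 1) - q * w (n - 2))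
    (hu0 : u 0 = 0) (hu1 : u 1 = 1)
    (hu : ∀ n : ℤ, u n = p * u (n - 1) - q * u (n - 2))
    (k : ℕ) (r s n m : ℤ)
    (hne1 : ∀ j : ℕ, j ≤ k → w (n - (m - r) * k + (m - r) * j) ≠ 0)
    (hne2 : ∀ j : ℕ, j ≤ k → w (n - (m - r) - (m - r) * k + (m - r) * j) ≠ 0) :
    -q ^ (r - s) * u (m - r) * w n * w (n - (m - r) * (k + 1)) * ∑ j ∈ Finset.range (k + 1), u (r - s) ^ (k - j) * u (m - s) ^ j * w (n - m + s - (m - r) * k + (m - r) * j) / (w (n - (m - r) * k + (m - r) * j) * w (n - (m - r) - (m - r) * k + (m - r) * j)) = u (r - s) ^ (k + 1) * w n - u (m - s) ^ (k + 1) * w (n - (m - r) * (k + 1)) := by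
  have hX (j : ℕ) : n - (m - r) - (m - r) * k + (m - r) * ((j + 1 : ℕ) : ℤ)
      = n - (m - r) * k + (m - r) * j := by
    push_cast
    ring
  have hstart : n - (m - r) - (m - r) * k + (m - r) * ((0 : ℕ) : ℤ)
      = n - (m - r) * (k + 1) := by
    push_cast
    ring
  have hend : n - (m - r) * k + (m - r) * (k : ℤ) = n := by ring
  have hwn : w n ≠ 0 := by simpa only [hend] using hne1 k le_rfl
  have hws : w (n - (m - r) * (k + 1)) ≠ 0 := by simpa only [hstart] using hne2 0 k.zero_le
  have htel := Finset.sum_range_sub' (fun j : ℕ => u (r - s) ^ (k + 1 - j) * u (m - s) ^ j /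
    w (n - (m - r) - (m - r) * k + (m - r) * j)) (k + 1)
  simp only [hX, hstart, hend, Nat.sub_self, Nat.sub_zero, pow_zero, one_mul, mul_one] at htel
  have hsum : -q ^ (r - s) * u (m - r) * ∑ j ∈ Finset.range (k + 1),
      u (r - s) ^ (k - j) * u (m - s) ^ j * w (n - m + s - (m - r) * k + (m - r) * j) /
        (w (n - (m - r) * k + (m - r) * j) * w (n - (m - r) - (m - r) * k + (m - r) * j))
      = u (r - s) ^ (k + 1) / w (n - (m - r) * (k + 1)) - u (m - s) ^ (k + 1) / w n := by
    rw [← htel, Finset.mul_sum]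
    refine Finset.sum_congr rfl fun j hj => ?_
    have hjk : j ≤ k := Nat.lt_succ_iff.mp (Finset.mem_range.mp hj)
    have h := horadam_sub_mul hq hw hu0 hu1 hu
      (n - (m - r) - (m - r) * k + (m - r) * j) (r - s) (m - r)
    rw [show n - (m - r) - (m - r) * k + (m - r) * j + (m - r)
        = n - (m - r) * k + (m - r) * j by ring, show r - s + (m - r) = m - s by ring,
      show n - (m - r) - (m - r) * k + (m - r) * j - (r - s)
        = n - m + s - (m - r) * k + (m - r) * j by ring] at h
    have h1 := hne1 j hjk
    have h2 := hne2 j hjk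
    rw [Nat.add_sub_add_right, Nat.sub_add_comm hjk, div_sub_div _ _ h2 h1, ← mul_div_assoc,
      mul_comm (w (n - (m - r) * k + (m - r) * j))]
    congr 1
    linear_combination -(u (r - s) ^ (k - j) * u (m - s) ^ j) * h
  calc
    _ = w n * w (n - (m - r) * (k + 1)) * (u (r - s) ^ (k + 1) / w (n - (m - r) * (k + 1))
        - u (m - s) ^ (k + 1) / w n) := by
      rw [← hsum]
      ring
    _ = _ := by field_simp
end
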